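/- arXiv:2510.15380 — 2 statements merged into one kernel-verified Lean document; each statement's English description precedes it below -/
import Mathlib

section
/- Let m ≥ 1 and let μ be a phase-symmetric probability measure on ℂ^m (coordinates indexed by ZMod m). Let x_1, …, x_M ∈ ℂ^n and let Q, Q' be complex m×n matrices such that for every k ∈ {1, …, M} there exists a unit scalar θ_k ∈ ℂ with |θ_k| = 1 and Q x_k = θ_k · (Q' x_k). Then for every k, the pushforward of μ under h ↦ h ⊛ (Q x_k) equals the pushforward of μ under h ↦ h ⊛ (Q' x_k); i.e., the cyphertext distributions of Q and Q' coincide for every plaintext x_k. -/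
open MeasureTheory Complex

/-- Circular convolution on ℂ^m: (h ⊛ v)(i) = ∑ⱼ h(j) · v(i − j). -/
noncomputable def cconv {m : ℕ} [NeZero m] (h v : ZMod m → ℂ) : ZMod m → ℂ :=
  fun i => ∑ j : ZMod m, h j * v (i - j)

/-- A measure on ℂ^m is phase-symmetric if it is invariant under multiplication
by any global unit scalar. -/
def PhaseSymmetric {m : ℕ} (μ : Measure (ZMod m → ℂ)) : Prop :=
  ∀ θ : ℂ, ‖θ‖ = 1 → μ.map (fun h => θ • h) = μ

theorem cconv_smul_right {m : ℕ} [NeZero m] (θ : ℂ) (h v : ZMod m → ℂ) :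
    cconv h (θ • v) = cconv (θ • h) v := by
  funext i
  refine Finset.sum_congr rfl fun j _ => ?_
  simp only [Pi.smul_apply, smul_eq_mul]
  ring

theorem measurable_cconv_left {m : ℕ} [NeZero m] (v : ZMod m → ℂ) :
    Measurable fun h : ZMod m → ℂ => cconv h v := by
  unfold cconv
  fun_prop

theorem PhaseSymmetric.map_cconv_smul {m : ℕ} [NeZero m] {μ : Measure (ZMod m → ℂ)}
    (hμ : PhaseSymmetric μ) {θ : ℂ} (hθ : ‖θ‖ = 1) (v : ZMod m → ℂ) :
    μ.map (fun h => cconv h (θ • v)) = μ.map (fun h => cconv h v) := by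
  simp only [cconv_smul_right]
  conv_rhs => rw [← hμ θ hθ]
  exact (Measure.map_map (measurable_cconv_left v) (measurable_const_smul θ)).symm

/-- For a phase-symmetric filter distribution, if Q xₖ = θₖ · (Q' xₖ) with unit θₖ for
every k, then the cyphertext distributions of Q and Q' coincide for every plaintext. -/
theorem phase_symmetric_cyphertext_distributions_eq (m n M : ℕ) [NeZero m] (hm : 1 ≤ m)
    (μ : Measure (ZMod m → ℂ)) [IsProbabilityMeasure μ] (hμ : PhaseSymmetric μ)
    (x : Fin M → Fin n → ℂ) (Q Q' : Matrix (ZMod m) (Fin n) ℂ)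
    (hQQ' : ∀ k : Fin M, ∃ θ : ℂ, ‖θ‖ = 1 ∧ Q.mulVec (x k) = θ • Q'.mulVec (x k)) :
    ∀ k : Fin M,
      μ.map (fun h => cconv h (Q.mulVec (x k))) =
      μ.map (fun h => cconv h (Q'.mulVec (x k))) := by
  intro k
  obtain ⟨θ, hθ, hQ⟩ := hQQ' k
  rw [hQ]
  exact hμ.map_cconv_smul hθ _
end

section
/- Let n ≥ 2, s ≥ 2, and let x_1, …, x_M ∈ ℂ^n be s-sparse vectors with M · s·(s−1) < n·(n−1). Then there exists a Hermitian complex n×n matrix H of rank exactly 2 such that x_k^* H x_k = 0 (that is, ∑_{a,b} conj(x_k(a)) · H_{ab} · x_k(b) = 0) for every k ∈ {1, …, M}. -/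
/-- A vector x ∈ ℂ^n is s-sparse if its support has at most s elements. -/
def IsSparse {n : ℕ} (s : ℕ) (x : Fin n → ℂ) : Prop :=
  Set.ncard {i | x i ≠ 0} ≤ s

theorem exists_offDiag_not_mem_biUnion {ι α : Type*} [Fintype ι] [Fintype α] [DecidableEq α]
    (s : ℕ) (S : ι → Finset α) (hS : ∀ k, (S k).card ≤ s)
    (h : Fintype.card ι * (s * (s - 1)) < Fintype.card α * (Fintype.card α - 1)) :
    ∃ p q : α, p ≠ q ∧ ∀ k, ¬ (p ∈ S k ∧ q ∈ S k) := by
  by_contra! hc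
  have hsub : (Finset.univ : Finset α).offDiag ⊆ Finset.univ.biUnion fun k => (S k).offDiag := by
    rintro ⟨p, q⟩ hpq
    have hne : p ≠ q := (Finset.mem_offDiag.mp hpq).2.2
    obtain ⟨k, hp, hq⟩ := hc p q hne
    exact Finset.mem_biUnion.mpr ⟨k, Finset.mem_univ k, Finset.mem_offDiag.mpr ⟨hp, hq, hne⟩⟩
  have hcard := (Finset.card_le_card hsub).trans
    (Finset.card_biUnion_le_card_mul _ _ (s * (s - 1)) fun k _ => by
      rw [Finset.offDiag_card, ← Nat.mul_sub_one]
      exact Nat.mul_le_mul (hS k) (Nat.sub_le_sub_right (hS k) 1))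
  rw [Finset.offDiag_card, ← Nat.mul_sub_one, Finset.card_univ, Finset.card_univ] at hcard
  exact absurd hcard (not_le.mpr h)

theorem rank_single_add_single_swap {α K : Type*} [Fintype α] [DecidableEq α] [Field K]
    {p q : α} (hpq : p ≠ q) :
    (Matrix.single p q (1 : K) + Matrix.single q p 1).rank = 2 := by
  classical
  have heq : Matrix.single p q (1 : K) + Matrix.single q p 1 =
      (Matrix.diagonal fun i => if i ∈ ({p, q} : Finset α) then (1 : K) else 0).submatrix
        (Equiv.swap p q) (Equiv.refl α) := by
    ext i j
    simp only [Matrix.add_apply, Matrix.single_apply, Matrix.submatrix_apply,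
      Matrix.diagonal_apply, Equiv.swap_apply_def, Equiv.refl_apply, Finset.mem_insert,
      Finset.mem_singleton]
    grind
  rw [heq, Matrix.rank_submatrix, Matrix.rank_diagonal]
  simp only [ne_eq, ite_eq_right_iff, one_ne_zero, imp_false, not_not]
  rw [Fintype.card_coe, Finset.card_pair hpq]

/-- For s-sparse vectors with M·s(s−1) < n(n−1) there is a Hermitian matrix H of rank
exactly 2 with xₖ*Hxₖ = 0 for every k. -/
theorem exists_hermitian_rank_two_annihilator (n M s : ℕ) (hn : 2 ≤ n) (hs : 2 ≤ s)
    (x : Fin M → Fin n → ℂ) (hx : ∀ k, IsSparse s (x k))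
    (hM : M * (s * (s - 1)) < n * (n - 1)) :
    ∃ H : Matrix (Fin n) (Fin n) ℂ, H.IsHermitian ∧ H.rank = 2 ∧
      ∀ k, ∑ a, ∑ b, star (x k a) * H a b * x k b = 0 := by
  obtain ⟨p, q, hpq, hS⟩ := exists_offDiag_not_mem_biUnion s
    (fun k => Finset.univ.filter fun i => x k i ≠ 0)
    (fun k => by simpa [IsSparse, Set.ncard_eq_toFinset_card'] using hx k) (by simpa using hM)
  refine ⟨Matrix.single p q 1 + Matrix.single q p 1, ?_, rank_single_add_single_swap hpq, ?_⟩
  · simp [Matrix.IsHermitian, Matrix.conjTranspose_add, add_comm]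
  · intro k
    have hk : x k p = 0 ∨ x k q = 0 := by
      have := hS k
      simp only [Finset.mem_filter, Finset.mem_univ, true_and] at this
      tauto
    refine Finset.sum_eq_zero fun a _ => Finset.sum_eq_zero fun b _ => ?_
    rw [Matrix.add_apply, Matrix.single_apply, Matrix.single_apply]
    rcases hk with h | h <;> split_ifs <;> simp_all
end
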